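/- Let (C, μ) be a flat-foldable MV pattern and let α = (c_i, …, c_{i+k}) be a crimpable sequence of C, having k + 1 creases. If k + 1 is even, then the number of creases of α with μ-value M equals the number with μ-value V; if k + 1 is odd, then these two counts differ by exactly one. -/

import Mathlib

/-- Mountain or valley label for a crease. -/
inductive MV : Type
  | M : MV
  | V : MV
deriving DecidableEq

/-- `(c 0, c 1, …, c n)` is a 1D crease pattern: a strictly increasing finite
sequence of reals with `n ≥ 1`.  The points `c 1, …, c (n-1)` are its creases,
`c 0` and `c n` its ends. -/
def IsCreasePattern (n : ℕ) (c : ℕ → ℝ) : Prop :=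
  1 ≤ n ∧ ∀ i j : ℕ, i < j → j ≤ n → c i < c j

/-- The consecutive creases `(c i, …, c (i+k))` form a crimpable sequence with gap `d`. -/
def IsCrimpable (n : ℕ) (c : ℕ → ℝ) (i k : ℕ) (d : ℝ) : Prop :=
  1 ≤ i ∧ 1 ≤ k ∧ i + k ≤ n - 1 ∧
  (∀ m : ℕ, i ≤ m → m < i + k → c (m + 1) - c m = d) ∧
  d < c i - c (i - 1) ∧ d < c (i + k + 1) - c (i + k)

/-- Additive offset of the folded-position map on the `j`-th interval:
on `[c j, c (j+1)]` the folded-position map is `x ↦ (-1)^j * x + foldOffset c j`. -/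
def foldOffset (c : ℕ → ℝ) : ℕ → ℝ
  | 0 => 0
  | j + 1 => foldOffset c (j) + 2 * (-1 : ℝ) ^ j * c (j + 1)

/-- Folded position of a point `x` belonging to the `j`-th interval `[c j, c (j+1)]`.
This is the unique continuous map equal to the identity on `[c 0, c 1]`, isometric on
every interval, and reversing direction at every crease. -/
def foldPos (c : ℕ → ℝ) (j : ℕ) (x : ℝ) : ℝ := (-1 : ℝ) ^ j * x + foldOffset c j

/-- Folded position of the crease `c i`. -/
def foldCrease (c : ℕ → ℝ) (i : ℕ) : ℝ := foldPos c i (c i)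

/-- `x` lies strictly `lt`-between `a` and `b`. -/
def Between (lt : ℕ → ℕ → Prop) (a b x : ℕ) : Prop :=
  (lt a x ∧ lt x b) ∨ (lt b x ∧ lt x a)

/-- The MV pattern `(C, μ)` is flat-foldable: there is a strict linear order `lt`
("strictly below") on the intervals `I_0, …, I_{n-1}` (indexed `0, …, n-1`) such that:
(i) for each crease `i`, `I_{i-1}` is below `I_i` iff either `μ i = V` and the folded map
is increasing on `I_{i-1}` (slope `(-1)^(i-1) = 1`), or `μ i = M` and it is decreasing;
(ii) for each crease `i` and each interval `J` whose folded image contains the folded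
crease position in its interior, `J` is not strictly between `I_{i-1}` and `I_i`;
(iii) for distinct creases `i, j` folding to the same point, it is not the case that
exactly one of `I_{j-1}`, `I_j` is strictly between `I_{i-1}` and `I_i`. -/
def IsFlatFoldable (n : ℕ) (c : ℕ → ℝ) (μ : ℕ → MV) : Prop :=
  ∃ lt : ℕ → ℕ → Prop,
    (∀ j, j < n → ¬ lt j j) ∧
    (∀ a b e, lt a b → lt b e → lt a e) ∧
    (∀ a b, a < n → b < n → a ≠ b → lt a b ∨ lt b a) ∧
    (∀ a b, lt a b → a < n ∧ b < n) ∧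
    (∀ i, 1 ≤ i → i ≤ n - 1 →
      (lt (i - 1) i ↔ ((μ i = MV.V ∧ Even (i - 1)) ∨ (μ i = MV.M ∧ Odd (i - 1))))) ∧
    (∀ i, 1 ≤ i → i ≤ n - 1 → ∀ j, j < n →
      foldCrease c i ∈
        Set.Ioo (min (foldPos c j (c j)) (foldPos c j (c (j + 1))))
                (max (foldPos c j (c j)) (foldPos c j (c (j + 1)))) →
      ¬ Between lt (i - 1) i j) ∧
    (∀ i j, 1 ≤ i → i ≤ n - 1 → 1 ≤ j → j ≤ n - 1 → i ≠ j →
      foldCrease c i = foldCrease c j →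
      (Between lt (i - 1) i (j - 1) ↔ Between lt (i - 1) i j))

/-- `F` is a forcing set for the MV pattern `(C, μ)`: a set of creases such that the only
flat-foldable assignment agreeing with `μ` on `F` is `μ` itself (on all creases). -/
def IsForcingSet (n : ℕ) (c : ℕ → ℝ) (μ : ℕ → MV) (F : Set ℕ) : Prop :=
  F ⊆ Set.Icc 1 (n - 1) ∧
  ∀ ν : ℕ → MV, IsFlatFoldable n c ν → (∀ x ∈ F, ν x = μ x) →
    ∀ x, 1 ≤ x → x ≤ n - 1 → ν x = μ x

/-- The crease pattern produced by a monocrimp at the adjacent pair `(c j, c (j+1))`: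
it deletes `c j` and `c (j+1)` and translates all later points by `-2 * (c (j+1) - c j)`. -/
def monocrimpPattern (c : ℕ → ℝ) (j : ℕ) : ℕ → ℝ :=
  fun x => if x < j then c x else c (x + 2) - 2 * (c (j + 1) - c j)

/-- The integer `x` lies strictly between `a` and `b`. -/
def StrictlyBetween (a b x : ℤ) : Prop := (a < x ∧ x < b) ∨ (b < x ∧ x < a)

theorem strictlyBetween_iff_symm {a b x y : ℤ} (hax : a ≠ x) (hay : a ≠ y) (hbx : b ≠ x)
    (hby : b ≠ y) (h : StrictlyBetween a b x ↔ StrictlyBetween a b y) :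
    StrictlyBetween x y a ↔ StrictlyBetween x y b := by
  unfold StrictlyBetween at *
  omega

/-- A path `g 0, …, g N` of distinct heights, alternately joined by arcs on two sides of a
vertical line, is a *noncrossing path* if arcs on the same side do not cross and the two end
heights exceed all others. -/
structure NoncrossingPath (N : ℕ) (g : ℕ → ℤ) : Prop where
  injOn : ∀ a b, a ≤ N → b ≤ N → g a = g b → a = b
  lt_first : ∀ x, 1 ≤ x → x < N → g x < g 0
  lt_last : ∀ x, 1 ≤ x → x < N → g x < g N
  noncrossing : ∀ a b, a < N → b < N → a ≠ b → a % 2 = b % 2 →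
    (StrictlyBetween (g a) (g (a + 1)) (g b) ↔ StrictlyBetween (g a) (g (a + 1)) (g (b + 1)))

/-- Alternating sum of the directions of the arcs of a path. -/
def alternatingTurn (N : ℕ) (g : ℕ → ℤ) : ℤ :=
  ∑ x ∈ Finset.range N, (-1) ^ x * (g (x + 1) - g x).sign

/-- The path obtained by deleting the entries of index `p + 1` and `p + 2`. -/
def deletePair (g : ℕ → ℤ) (p : ℕ) : ℕ → ℤ := fun x => if x ≤ p then g x else g (x + 2)

theorem deletePair_of_le {g : ℕ → ℤ} {p x : ℕ} (h : x ≤ p) : deletePair g p x = g x :=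
  if_pos h

theorem deletePair_of_lt {g : ℕ → ℤ} {p x : ℕ} (h : p < x) : deletePair g p x = g (x + 2) :=
  if_neg (by omega)

/-- Noncrossing only needs to be checked for ordered pairs of arcs. -/
theorem noncrossing_of_lt {N : ℕ} {g : ℕ → ℤ}
    (hinj : ∀ a b, a ≤ N → b ≤ N → g a = g b → a = b)
    (h : ∀ a b, b < N → a < b → a % 2 = b % 2 →
      (StrictlyBetween (g a) (g (a + 1)) (g b) ↔ StrictlyBetween (g a) (g (a + 1)) (g (b + 1))))
    (a b : ℕ) (ha : a < N) (hb : b < N) (hab : a ≠ b) (hpar : a % 2 = b % 2) :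
    StrictlyBetween (g a) (g (a + 1)) (g b) ↔ StrictlyBetween (g a) (g (a + 1)) (g (b + 1)) := by
  rcases Nat.lt_or_gt_of_ne hab with hlt | hlt
  · exact h a b hb hlt hpar
  · have hne : ∀ x y, x ≤ N → y ≤ N → x ≠ y → g x ≠ g y :=
      fun x y hx hy hxy he => hxy (hinj x y hx hy he)
    exact strictlyBetween_iff_symm (hne _ _ (by omega) (by omega) (by omega))
      (hne _ _ (by omega) (by omega) (by omega)) (hne _ _ (by omega) (by omega) (by omega))
      (hne _ _ (by omega) (by omega) (by omega)) (h b a ha hlt hpar.symm)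

namespace NoncrossingPath

variable {N : ℕ} {g : ℕ → ℤ}

theorem ne (hg : NoncrossingPath N g) {x y : ℕ} (hx : x ≤ N) (hy : y ≤ N) (h : x ≠ y) :
    g x ≠ g y := fun he => h (hg.injOn x y hx hy he)

/-- Some arc avoiding both ends joins two vertically adjacent entries. -/
theorem exists_adjacent (hg : NoncrossingPath N g) (hN : 4 ≤ N) :
    ∃ p, p + 3 ≤ N ∧ ∀ x, x ≤ N → ¬ StrictlyBetween (g (p + 1)) (g (p + 2)) (g x) := by
  classical
  let inside : ℕ → Finset ℕ := fun p =>
    (Finset.range (N + 1)).filter fun x => StrictlyBetween (g (p + 1)) (g (p + 2)) (g x)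
  obtain ⟨p, hp, hmin⟩ := Finset.exists_min_image (Finset.range (N - 2))
    (fun p => (inside p).card) ⟨0, by simp; omega⟩
  rw [Finset.mem_range] at hp
  refine ⟨p, by omega, fun x hx hbet => ?_⟩
  have hends : ∀ y, y ≤ N → StrictlyBetween (g (p + 1)) (g (p + 2)) (g y) → 1 ≤ y ∧ y < N := by
    intro y hy hby
    have h1 := hg.lt_first (p + 1) (by omega) (by omega)
    have h2 := hg.lt_first (p + 2) (by omega) (by omega)
    have h3 := hg.lt_last (p + 1) (by omega) (by omega)
    have h4 := hg.lt_last (p + 2) (by omega) (by omega)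
    unfold StrictlyBetween at hby
    constructor
    · by_contra h
      obtain rfl : y = 0 := by omega
      omega
    · by_contra h
      obtain rfl : y = N := by omega
      omega
  have hxe := hends x hx hbet
  have hx1 : x ≠ p + 1 := by rintro rfl; unfold StrictlyBetween at hbet; omega
  have hx2 : x ≠ p + 2 := by rintro rfl; unfold StrictlyBetween at hbet; omega
  obtain ⟨b, hbx, hpar⟩ : ∃ b, (b = x ∨ b + 1 = x) ∧ (p + 1) % 2 = b % 2 := by
    by_cases h : (p + 1) % 2 = x % 2
    · exact ⟨x, Or.inl rfl, h⟩
    · exact ⟨x - 1, Or.inr (by omega), by omega⟩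
  have hnc := hg.noncrossing (p + 1) b (by omega) (by omega) (by omega) hpar
  have hb : StrictlyBetween (g (p + 1)) (g (p + 2)) (g b) ∧
      StrictlyBetween (g (p + 1)) (g (p + 2)) (g (b + 1)) := by
    rcases hbx with rfl | rfl
    · exact ⟨hbet, hnc.1 hbet⟩
    · exact ⟨hnc.2 hbet, hbet⟩
  have hb1 := hends b (by omega) hb.1
  have hb2 := hends (b + 1) (by omega) hb.2
  obtain ⟨q, rfl⟩ : ∃ q, b = q + 1 := ⟨b - 1, by omega⟩
  have hlt : (inside q).card < (inside p).card := by
    apply Finset.card_lt_card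
    refine Finset.ssubset_iff_of_subset ?_ |>.2 ⟨q + 1, ?_, ?_⟩
    · intro y hy
      simp only [inside, Finset.mem_filter] at hy ⊢
      refine ⟨hy.1, ?_⟩
      have hy2 := hy.2
      have h1 := hb.1
      have h2 := hb.2
      rw [show q + 1 + 1 = q + 2 from rfl] at h2
      unfold StrictlyBetween at *
      omega
    · simp only [inside, Finset.mem_filter, Finset.mem_range]
      exact ⟨by omega, hb.1⟩
    · intro hmem
      have hself := (Finset.mem_filter.1 hmem).2
      unfold StrictlyBetween at hself
      omega
  have := hmin q (Finset.mem_range.2 (by omega))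
  omega

theorem deletePair {p : ℕ} (hg : NoncrossingPath (N + 2) g) (hp : p + 1 ≤ N)
    (hadj : ∀ x, x ≤ N + 2 → ¬ StrictlyBetween (g (p + 1)) (g (p + 2)) (g x)) :
    NoncrossingPath N (deletePair g p) := by
  have hinj : ∀ a b, a ≤ N → b ≤ N → _root_.deletePair g p a = _root_.deletePair g p b →
      a = b := by
    intro a b ha hb h
    unfold _root_.deletePair at h
    split_ifs at h <;> have := hg.injOn _ _ (by omega) (by omega) h <;> omega
  have hnew : ∀ b, b < N + 2 → b ≠ p → b ≠ p + 1 → b ≠ p + 2 → b % 2 = p % 2 →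
      (StrictlyBetween (g b) (g (b + 1)) (g p) ↔
        StrictlyBetween (g b) (g (b + 1)) (g (p + 3))) := by
    intro b hb h0 h1 h2 hpar
    have e1 := hg.noncrossing b p hb (by omega) h0 hpar
    have e2 := hg.noncrossing b (p + 2) hb (by omega) h2 (by omega)
    have a1 := hadj b (by omega)
    have a2 := hadj (b + 1) (by omega)
    have n1 := hg.ne (x := b) (y := p + 1) (by omega) (by omega) (by omega)
    have n2 := hg.ne (x := b) (y := p + 2) (by omega) (by omega) (by omega)
    have n3 := hg.ne (x := b + 1) (y := p + 1) (by omega) (by omega) (by omega)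
    have n4 := hg.ne (x := b + 1) (y := p + 2) (by omega) (by omega) (by omega)
    have e : StrictlyBetween (g b) (g (b + 1)) (g (p + 1)) ↔
        StrictlyBetween (g b) (g (b + 1)) (g (p + 2)) := by
      unfold StrictlyBetween at a1 a2 ⊢
      omega
    exact e1.trans (e.trans e2)
  refine ⟨hinj, ?_, ?_, noncrossing_of_lt hinj ?_⟩
  · intro x hx hxN
    rw [deletePair_of_le (Nat.zero_le p)]
    unfold _root_.deletePair
    split_ifs
    · exact hg.lt_first _ hx (by omega)
    · exact hg.lt_first _ (by omega) (by omega)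
  · intro x hx hxN
    rw [deletePair_of_lt (show p < N by omega)]
    unfold _root_.deletePair
    split_ifs
    · exact hg.lt_last _ hx (by omega)
    · exact hg.lt_last _ (by omega) (by omega)
  · intro a b hb hab hpar
    rcases Nat.lt_trichotomy b p with hbp | rfl | hbp
    · rw [deletePair_of_le (by omega), deletePair_of_le (by omega), deletePair_of_le (by omega),
        deletePair_of_le (by omega)]
      exact hg.noncrossing a b (by omega) (by omega) (by omega) hpar
    · rw [deletePair_of_le (by omega), deletePair_of_le (by omega), deletePair_of_le (by omega),
        deletePair_of_lt (by omega)]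
      exact hnew a (by omega) (by omega) (by omega) (by omega) hpar
    · rw [deletePair_of_lt hbp, deletePair_of_lt (show p < b + 1 by omega)]
      rcases Nat.lt_trichotomy a p with hap | rfl | hap
      · rw [deletePair_of_le (by omega), deletePair_of_le (by omega)]
        exact hg.noncrossing a (b + 2) (by omega) (by omega) (by omega) (by omega)
      · rw [deletePair_of_le le_rfl, deletePair_of_lt (Nat.lt_succ_self _)]
        exact strictlyBetween_iff_symm (hg.ne (by omega) (by omega) (by omega))
          (hg.ne (by omega) (by omega) (by omega)) (hg.ne (by omega) (by omega) (by omega))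
          (hg.ne (by omega) (by omega) (by omega))
          (hnew (b + 2) (by omega) (by omega) (by omega) (by omega) (by omega))
      · rw [deletePair_of_lt (by omega), deletePair_of_lt (by omega)]
        exact hg.noncrossing (a + 2) (b + 2) (by omega) (by omega) (by omega) (by omega)

theorem alternatingTurn_deletePair {p : ℕ} (hg : NoncrossingPath (N + 2) g) (hp : p + 1 ≤ N)
    (hadj : ∀ x, x ≤ N + 2 → ¬ StrictlyBetween (g (p + 1)) (g (p + 2)) (g x)) :
    alternatingTurn N (_root_.deletePair g p) = alternatingTurn (N + 2) g := by
  obtain ⟨r, rfl⟩ : ∃ r, N = p + 1 + r := ⟨N - (p + 1), by omega⟩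
  have hmid : (g (p + 3) - g p).sign = (g (p + 1) - g p).sign - (g (p + 2) - g (p + 1)).sign +
      (g (p + 3) - g (p + 2)).sign := by
    have e := hg.noncrossing p (p + 2) (by omega) (by omega) (by omega) (by omega)
    have a1 := hadj p (by omega)
    have a2 := hadj (p + 3) (by omega)
    have n1 := hg.ne (x := p) (y := p + 1) (by omega) (by omega) (by omega)
    have n2 := hg.ne (x := p) (y := p + 2) (by omega) (by omega) (by omega)
    have n3 := hg.ne (x := p) (y := p + 3) (by omega) (by omega) (by omega)
    have n4 := hg.ne (x := p + 1) (y := p + 2) (by omega) (by omega) (by omega)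
    have n5 := hg.ne (x := p + 1) (y := p + 3) (by omega) (by omega) (by omega)
    have n6 := hg.ne (x := p + 2) (y := p + 3) (by omega) (by omega) (by omega)
    have hsign : ∀ u v : ℤ, u ≠ v →
        (u < v ∧ (v - u).sign = 1) ∨ (v < u ∧ (v - u).sign = -1) := by
      intro u v huv
      rcases lt_or_gt_of_ne huv with h | h
      · exact Or.inl ⟨h, Int.sign_eq_one_of_pos (by omega)⟩
      · exact Or.inr ⟨h, Int.sign_eq_neg_one_of_neg (by omega)⟩
    have s1 := hsign _ _ n1
    have s2 := hsign _ _ n4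
    have s3 := hsign _ _ n6
    have s4 := hsign _ _ n3
    unfold StrictlyBetween at e a1 a2
    rw [show p + 2 + 1 = p + 3 from rfl] at e
    rcases s1 with ⟨s1, t1⟩ | ⟨s1, t1⟩ <;> rcases s2 with ⟨s2, t2⟩ | ⟨s2, t2⟩ <;>
      rcases s3 with ⟨s3, t3⟩ | ⟨s3, t3⟩ <;> rcases s4 with ⟨s4, t4⟩ | ⟨s4, t4⟩ <;>
      rw [t1, t2, t3, t4] <;> omega
  unfold alternatingTurn
  rw [show p + 1 + r + 2 = p + 3 + r by omega, Finset.sum_range_add _ (p + 1) r,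
    Finset.sum_range_add _ (p + 3) r, Finset.sum_range_succ _ (p + 2),
    Finset.sum_range_succ _ (p + 1), Finset.sum_range_succ _ p, Finset.sum_range_succ _ p]
  have hlow : ∑ x ∈ Finset.range p,
      (-1 : ℤ) ^ x * (_root_.deletePair g p (x + 1) - _root_.deletePair g p x).sign =
      ∑ x ∈ Finset.range p, (-1) ^ x * (g (x + 1) - g x).sign := by
    refine Finset.sum_congr rfl fun x hx => ?_
    rw [Finset.mem_range] at hx
    rw [deletePair_of_le (by omega), deletePair_of_le (by omega)]
  have hhigh : ∑ x ∈ Finset.range r, (-1 : ℤ) ^ (p + 1 + x) *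
        (_root_.deletePair g p (p + 1 + x + 1) - _root_.deletePair g p (p + 1 + x)).sign =
      ∑ x ∈ Finset.range r, (-1) ^ (p + 3 + x) * (g (p + 3 + x + 1) - g (p + 3 + x)).sign := by
    refine Finset.sum_congr rfl fun x _ => ?_
    rw [deletePair_of_lt (by omega), deletePair_of_lt (by omega),
      show p + 1 + x + 1 + 2 = p + 3 + x + 1 by omega, show p + 1 + x + 2 = p + 3 + x by omega,
      show p + 3 + x = p + 1 + x + 2 by omega, pow_add _ (p + 1 + x) 2]
    norm_num
  rw [hlow, hhigh, deletePair_of_le le_rfl, deletePair_of_lt (Nat.lt_succ_self p),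
    show p + 1 + 2 = p + 3 from rfl, hmid, show p + 2 + 1 = p + 3 from rfl,
    show p + 1 + 1 = p + 2 from rfl]
  ring

/-- The alternating turn of a noncrossing path is `-2` or `±1`, according to the parity of its
length. -/
theorem alternatingTurn_eq (hN : 2 ≤ N) (hg : NoncrossingPath N g) :
    (Even N → alternatingTurn N g = -2) ∧
      (Odd N → alternatingTurn N g = 1 ∨ alternatingTurn N g = -1) := by
  induction N using Nat.strong_induction_on generalizing g with
  | _ N ih =>
    rcases Nat.lt_or_ge N 4 with hlt | hge
    · have h1 := hg.lt_first 1 le_rfl (by omega)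
      have h2 := hg.lt_last 1 le_rfl (by omega)
      obtain rfl | rfl : N = 2 ∨ N = 3 := by omega
      · refine ⟨fun _ => ?_, fun h => absurd h (by decide)⟩
        simp only [alternatingTurn, Finset.sum_range_succ, Finset.sum_range_zero]
        norm_num
        rw [Int.sign_eq_neg_one_of_neg (by omega), Int.sign_eq_one_of_pos (by omega)]
        norm_num
      · refine ⟨fun h => absurd h (by decide), fun _ => ?_⟩
        have h3 := hg.lt_last 2 (by omega) (by omega)
        have h4 := hg.ne (x := 1) (y := 2) (by omega) (by omega) (by omega)
        simp only [alternatingTurn, Finset.sum_range_succ, Finset.sum_range_zero]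
        norm_num
        rw [Int.sign_eq_neg_one_of_neg (show g 1 - g 0 < 0 by omega),
          Int.sign_eq_one_of_pos (show 0 < g 3 - g 2 by omega)]
        rcases lt_or_gt_of_ne h4 with h | h
        · rw [Int.sign_eq_one_of_pos (by omega)]
          norm_num
        · rw [Int.sign_eq_neg_one_of_neg (by omega)]
          norm_num
    · obtain ⟨p, hp, hadj⟩ := hg.exists_adjacent hge
      obtain ⟨m, rfl⟩ : ∃ m, N = m + 2 := ⟨N - 2, by omega⟩
      have := ih m (by omega) (by omega) (hg.deletePair (by omega) hadj)
      rw [hg.alternatingTurn_deletePair (by omega) hadj] at this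
      simpa [Nat.even_add, Nat.odd_add] using this

end NoncrossingPath

theorem foldPos_right (c : ℕ → ℝ) (x : ℕ) : foldPos c x (c (x + 1)) = foldCrease c (x + 1) := by
  simp only [foldCrease, foldPos, foldOffset, pow_succ]
  ring

theorem foldCrease_succ (c : ℕ → ℝ) (x : ℕ) :
    foldCrease c (x + 1) = foldCrease c x + (-1) ^ x * (c (x + 1) - c x) := by
  rw [← foldPos_right, foldCrease, foldPos, foldPos]
  ring

namespace IsCrimpable

variable {n i k : ℕ} {c : ℕ → ℝ} {d : ℝ}

theorem foldCrease_add (h : IsCrimpable n c i k d) (m : ℕ) (hm : m ≤ k) :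
    foldCrease c (i + m) = foldCrease c i + if Even m then 0 else (-1) ^ i * d := by
  induction m with
  | zero => simp
  | succ m ih =>
    rw [← add_assoc, foldCrease_succ, ih (by omega), h.2.2.2.1 (i + m) (by omega) (by omega)]
    rcases Nat.even_or_odd m with hm | hm
    · simp [hm, Nat.even_add_one, pow_add, hm.neg_one_pow]
    · simp [Nat.not_even_iff_odd.2 hm, Nat.even_add_one, pow_add, hm.neg_one_pow]

theorem foldCrease_eq_of_parity (h : IsCrimpable n c i k d) {x y : ℕ} (hx : i ≤ x)
    (hxk : x ≤ i + k) (hy : i ≤ y) (hyk : y ≤ i + k) (hxy : x % 2 = y % 2) :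
    foldCrease c x = foldCrease c y := by
  obtain ⟨a, rfl⟩ := Nat.exists_eq_add_of_le hx
  obtain ⟨b, rfl⟩ := Nat.exists_eq_add_of_le hy
  rw [h.foldCrease_add a (by omega), h.foldCrease_add b (by omega)]
  have : Even a ↔ Even b := by rw [Nat.even_iff, Nat.even_iff]; omega
  simp [this]

theorem foldCrease_mem_left (h : IsCrimpable n c i k d) (hd : 0 < d) {x : ℕ} (hx : i ≤ x)
    (hxk : x ≤ i + k) (hpar : x % 2 ≠ i % 2) :
    foldCrease c x ∈ Set.Ioo
      (min (foldPos c (i - 1) (c (i - 1))) (foldPos c (i - 1) (c (i - 1 + 1))))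
      (max (foldPos c (i - 1) (c (i - 1))) (foldPos c (i - 1) (c (i - 1 + 1)))) := by
  obtain ⟨a, rfl⟩ := Nat.exists_eq_add_of_le hx
  have hodd : ¬ Even a := by rw [Nat.even_iff]; omega
  rw [foldPos_right, h.foldCrease_add a (by omega), if_neg hodd]
  change _ ∈ Set.Ioo (min (foldCrease c (i - 1)) _) (max (foldCrease c (i - 1)) _)
  have hL := h.2.2.2.2.1
  obtain ⟨j, rfl⟩ : ∃ j, i = j + 1 := ⟨i - 1, by have := h.1; omega⟩
  simp only [Nat.add_sub_cancel] at hL ⊢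
  rw [foldCrease_succ, Set.mem_Ioo, min_lt_iff, lt_max_iff, pow_succ]
  rcases neg_one_pow_eq_or ℝ j with hs | hs <;> rw [hs]
  · exact ⟨Or.inl (by linarith), Or.inr (by linarith)⟩
  · exact ⟨Or.inr (by linarith), Or.inl (by linarith)⟩

theorem foldCrease_mem_right (h : IsCrimpable n c i k d) (hd : 0 < d) {x : ℕ} (hx : i ≤ x)
    (hxk : x ≤ i + k) (hpar : x % 2 ≠ (i + k) % 2) :
    foldCrease c x ∈ Set.Ioo
      (min (foldPos c (i + k) (c (i + k))) (foldPos c (i + k) (c (i + k + 1))))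
      (max (foldPos c (i + k) (c (i + k))) (foldPos c (i + k) (c (i + k + 1)))) := by
  have hpos : foldCrease c x = foldCrease c (i + k) + (-1) ^ (i + k) * d := by
    obtain ⟨a, rfl⟩ := Nat.exists_eq_add_of_le hx
    rw [h.foldCrease_add a (by omega), h.foldCrease_add k le_rfl]
    rcases Nat.even_or_odd k with hk | hk
    · have ha : ¬ Even a := by rw [Nat.even_iff] at hk ⊢; omega
      simp [hk, ha, pow_add, hk.neg_one_pow]
    · have ha : Even a := by rw [Nat.odd_iff] at hk; rw [Nat.even_iff]; omega
      have hk' : ¬ Even k := Nat.not_even_iff_odd.2 hk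
      simp [hk', ha, pow_add, hk.neg_one_pow]
  rw [foldPos_right, hpos, foldCrease_succ]
  change _ ∈ Set.Ioo (min (foldCrease c (i + k)) _) (max (foldCrease c (i + k)) _)
  have hL := h.2.2.2.2.2
  rw [Set.mem_Ioo, min_lt_iff, lt_max_iff]
  rcases neg_one_pow_eq_or ℝ (i + k) with hs | hs <;> rw [hs]
  · exact ⟨Or.inl (by linarith), Or.inr (by linarith)⟩
  · exact ⟨Or.inr (by linarith), Or.inl (by linarith)⟩

end IsCrimpable

/-- A strict linear order on `0, …, n - 1` is given by an integer height. -/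
theorem exists_height (n : ℕ) (lt : ℕ → ℕ → Prop) (hirr : ∀ j, j < n → ¬ lt j j)
    (htrans : ∀ a b e, lt a b → lt b e → lt a e)
    (htot : ∀ a b, a < n → b < n → a ≠ b → lt a b ∨ lt b a) :
    ∃ h : ℕ → ℤ, (∀ a, h a ≤ n) ∧ ∀ a b, a < n → b < n → (lt a b ↔ h a < h b) := by
  classical
  let below : ℕ → Finset ℕ := fun a => (Finset.range n).filter fun y => lt y a
  have hmono : ∀ a b, a < n → lt a b → (below a).card < (below b).card := by
    intro a b ha hab
    apply Finset.card_lt_card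
    refine Finset.ssubset_iff_of_subset ?_ |>.2 ⟨a, ?_, ?_⟩
    · intro y hy
      simp only [below, Finset.mem_filter] at hy ⊢
      exact ⟨hy.1, htrans _ _ _ hy.2 hab⟩
    · simp [below, ha, hab]
    · simp [below, hirr a ha]
  refine ⟨fun a => ((below a).card : ℤ), fun a => ?_, fun a b ha hb => ?_⟩
  · exact Nat.cast_le.2 ((Finset.card_filter_le _ _).trans_eq (Finset.card_range n))
  · refine ⟨fun hab => Nat.cast_lt.2 (hmono a b ha hab), fun hab => ?_⟩
    have hab' : (below a).card < (below b).card := Nat.cast_lt.1 hab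
    have hne : a ≠ b := by rintro rfl; exact lt_irrefl _ hab'
    exact (htot a b ha hb hne).resolve_right fun hba => lt_asymm hab' (hmono b a hb hba)

/-- The heights of the layers around a crimpable sequence, together with two end values above all
layers; the latter are ordered so that the arcs reaching them do not cross. -/
def layerPath (h : ℕ → ℤ) (n i k : ℕ) : ℕ → ℤ := fun x =>
  if x = 0 then (if h (i - 1) < h (i + k) then n + 2 else n + 1)
  else if x = k + 3 then (if h (i - 1) < h (i + k) then n + 1 else n + 2)
  else h (i + x - 2)

theorem layerPath_of_mem {h : ℕ → ℤ} {n i k x : ℕ} (h0 : 1 ≤ x) (h1 : x < k + 3) :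
    layerPath h n i k x = h (i + x - 2) := by
  rw [layerPath, if_neg (by omega), if_neg (by omega)]

theorem IsCrimpable.noncrossingPath_layerPath {n i k : ℕ} {c : ℕ → ℝ} {d : ℝ}
    (hα : IsCrimpable n c i k d) (hd : 0 < d) {h : ℕ → ℤ} (hn : ∀ a, h a ≤ n)
    (hinj : ∀ a b, a < n → b < n → h a = h b → a = b)
    (hside : ∀ x, 1 ≤ x → x ≤ n - 1 → ∀ j, j < n →
      foldCrease c x ∈
        Set.Ioo (min (foldPos c j (c j)) (foldPos c j (c (j + 1))))
                (max (foldPos c j (c j)) (foldPos c j (c (j + 1)))) →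
      ¬ StrictlyBetween (h (x - 1)) (h x) (h j))
    (hcross : ∀ x y, 1 ≤ x → x ≤ n - 1 → 1 ≤ y → y ≤ n - 1 → x ≠ y →
      foldCrease c x = foldCrease c y →
      (StrictlyBetween (h (x - 1)) (h x) (h (y - 1)) ↔
        StrictlyBetween (h (x - 1)) (h x) (h y))) :
    NoncrossingPath (k + 3) (layerPath h n i k) := by
  have hi := hα.1
  have hik := hα.2.2.1
  have hk := hα.2.1
  have hfirst : layerPath h n i k 0 = if h (i - 1) < h (i + k) then (n + 2 : ℤ) else n + 1 := rfl
  have hlast : layerPath h n i k (k + 3) =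
      if h (i - 1) < h (i + k) then (n + 1 : ℤ) else n + 2 := by simp [layerPath]
  have hbound : ∀ x, 1 ≤ x → x < k + 3 → layerPath h n i k x ≤ n :=
    fun x h0 h1 => by rw [layerPath_of_mem h0 h1]; exact hn _
  have hginj : ∀ a b, a ≤ k + 3 → b ≤ k + 3 →
      layerPath h n i k a = layerPath h n i k b → a = b := by
    intro a b ha hb hab
    have := hn (i + a - 2)
    have := hn (i + b - 2)
    unfold layerPath at hab
    split_ifs at hab <;> first
      | omega
      | (have := hinj _ _ (by omega) (by omega) hab; omega)
  have hgne : ∀ x y, x ≤ k + 3 → y ≤ k + 3 → x ≠ y →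
      layerPath h n i k x ≠ layerPath h n i k y :=
    fun x y hx hy hxy he => hxy (hginj x y hx hy he)
  refine ⟨hginj, ?_, ?_, noncrossing_of_lt hginj ?_⟩
  · intro x h0 h1
    have := hbound x h0 h1
    rw [hfirst]
    split_ifs <;> omega
  · intro x h0 h1
    have := hbound x h0 h1
    rw [hlast]
    split_ifs <;> omega
  · intro a b hb hab hpar
    rcases Nat.eq_zero_or_pos a with rfl | ha
    · have e1 : layerPath h n i k (0 + 1) = h (i - 1) := layerPath_of_mem le_rfl (by omega)
      by_cases hbk : b = k + 2
      · subst hbk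
        have e2 : layerPath h n i k (k + 2) = h (i + k) :=
          layerPath_of_mem (by omega) (by omega)
        rw [hfirst, e1, e2, hlast]
        have := hn (i - 1)
        have := hn (i + k)
        have : h (i - 1) ≠ h (i + k) := fun he => by
          have := hinj _ _ (by omega) (by omega) he
          omega
        unfold StrictlyBetween
        split_ifs <;> omega
      · apply strictlyBetween_iff_symm (hgne _ _ (by omega) (by omega) (by omega))
          (hgne _ _ (by omega) (by omega) (by omega)) (hgne _ _ (by omega) (by omega) (by omega))
          (hgne _ _ (by omega) (by omega) (by omega))
        have hs := hside (i + b - 1) (by omega) (by omega) (i - 1) (by omega)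
          (hα.foldCrease_mem_left hd (by omega) (by omega) (by omega))
        have b1 := hbound b (by omega) (by omega)
        have b2 := hbound (b + 1) (by omega) (by omega)
        have e2 : layerPath h n i k b = h (i + b - 1 - 1) :=
          layerPath_of_mem (by omega) (by omega)
        have e3 : layerPath h n i k (b + 1) = h (i + b - 1) := by
          rw [layerPath_of_mem (by omega) (by omega)]
          congr 1
        rw [← e1, ← e2, ← e3] at hs
        refine iff_of_false ?_ hs
        rw [hfirst]
        unfold StrictlyBetween
        split_ifs <;> omega
    · have e1 : layerPath h n i k a = h (i + a - 1 - 1) := layerPath_of_mem (by omega) (by omega)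
      have e2 : layerPath h n i k (a + 1) = h (i + a - 1) := by
        rw [layerPath_of_mem (by omega) (by omega)]
        congr 1
      by_cases hbk : b = k + 2
      · subst hbk
        have hs := hside (i + a - 1) (by omega) (by omega) (i + k) (by omega)
          (hα.foldCrease_mem_right hd (by omega) (by omega) (by omega))
        have b1 := hbound a (by omega) (by omega)
        have b2 := hbound (a + 1) (by omega) (by omega)
        have e3 : layerPath h n i k (k + 2) = h (i + k) :=
          layerPath_of_mem (by omega) (by omega)
        rw [← e1, ← e2, ← e3] at hs
        refine iff_of_false hs ?_
        rw [show k + 2 + 1 = k + 3 from rfl, hlast]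
        unfold StrictlyBetween
        split_ifs <;> omega
      · have e3 : layerPath h n i k b = h (i + b - 1 - 1) :=
          layerPath_of_mem (by omega) (by omega)
        have e4 : layerPath h n i k (b + 1) = h (i + b - 1) := by
          rw [layerPath_of_mem (by omega) (by omega)]
          congr 1
        rw [e1, e2, e3, e4]
        exact hcross (i + a - 1) (i + b - 1) (by omega) (by omega) (by omega) (by omega)
          (by omega) (hα.foldCrease_eq_of_parity (by omega) (by omega) (by omega) (by omega)
            (by omega))

/-- The signed contribution of a crease label: `1` for a valley and `-1` for a mountain. -/
def MV.toSign : MV → ℤ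
  | MV.M => -1
  | MV.V => 1

theorem sum_toSign (s : Finset ℕ) (μ : ℕ → MV) :
    ∑ x ∈ s, (μ x).toSign =
      ((s.filter (fun x => μ x = MV.V)).card : ℤ) - (s.filter (fun x => μ x = MV.M)).card := by
  rw [Finset.card_filter, Finset.card_filter]
  push_cast
  rw [← Finset.sum_sub_distrib]
  refine Finset.sum_congr rfl fun x _ => ?_
  cases μ x <;> simp [MV.toSign]

/-- Hull's theorem on crimpable sequences: in a flat-foldable MV pattern, over the
`k + 1` creases of a crimpable sequence `(c i, …, c (i+k))`, the numbers of `M` and `V`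
assignments are equal when `k + 1` is even, and differ by exactly one when `k + 1` is odd. -/
theorem crimpable_MV_count (n : ℕ) (c : ℕ → ℝ) (μ : ℕ → MV)
    (hC : IsCreasePattern n c) (hF : IsFlatFoldable n c μ)
    (i k : ℕ) (d : ℝ) (hα : IsCrimpable n c i k d) :
    (Even (k + 1) →
      ((Finset.Icc i (i + k)).filter (fun x => μ x = MV.M)).card =
        ((Finset.Icc i (i + k)).filter (fun x => μ x = MV.V)).card) ∧
    (Odd (k + 1) →
      ((Finset.Icc i (i + k)).filter (fun x => μ x = MV.M)).card =
          ((Finset.Icc i (i + k)).filter (fun x => μ x = MV.V)).card + 1 ∨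
        ((Finset.Icc i (i + k)).filter (fun x => μ x = MV.V)).card =
          ((Finset.Icc i (i + k)).filter (fun x => μ x = MV.M)).card + 1) := by
  obtain ⟨lt, hirr, htrans, htot, -, hdir, hside, hcross⟩ := hF
  obtain ⟨h, hn, hlt⟩ := exists_height n lt hirr htrans htot
  have hi := hα.1
  have hk := hα.2.1
  have hik := hα.2.2.1
  have hd : 0 < d := by
    rw [← hα.2.2.2.1 i le_rfl (by omega)]
    exact sub_pos.2 (hC.2 _ _ (by omega) (by omega))
  have hinj : ∀ a b, a < n → b < n → h a = h b → a = b := by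
    intro a b ha hb hab
    by_contra hne
    rcases htot a b ha hb hne with hl | hl
    · have := (hlt a b ha hb).1 hl
      omega
    · have := (hlt b a hb ha).1 hl
      omega
  have hbet : ∀ a b x, a < n → b < n → x < n →
      (Between lt a b x ↔ StrictlyBetween (h a) (h b) (h x)) := by
    intro a b x ha hb hx
    rw [Between, StrictlyBetween, hlt a x ha hx, hlt x b hx hb, hlt b x hb hx, hlt x a hx ha]
  have hpath : NoncrossingPath (k + 3) (layerPath h n i k) := by
    refine hα.noncrossingPath_layerPath hd hn hinj ?_ ?_
    · intro x h1 h2 j hj hmem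
      rw [← hbet _ _ _ (by omega) (by omega) hj]
      exact hside x h1 h2 j hj hmem
    · intro x y h1 h2 h3 h4 hne he
      rw [← hbet _ _ _ (by omega) (by omega) (by omega),
        ← hbet _ _ _ (by omega) (by omega) (by omega)]
      exact hcross x y h1 h2 h3 h4 hne he
  have hsum : alternatingTurn (k + 3) (layerPath h n i k) =
      (-1) ^ i * ∑ x ∈ Finset.Icc i (i + k), (μ x).toSign - 1 + (-1) ^ k := by
    have hfirst := hpath.lt_first 1 le_rfl (by omega)
    have hlast := hpath.lt_last (k + 2) (by omega) (by omega)
    have hIcc : Finset.Icc i (i + k) = Finset.Ico i (i + (k + 1)) := by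
      ext x
      simp only [Finset.mem_Icc, Finset.mem_Ico]
      omega
    rw [alternatingTurn, Finset.sum_range_succ, Finset.sum_range_succ',
      Int.sign_eq_one_of_pos
        (show 0 < layerPath h n i k (k + 2 + 1) - layerPath h n i k (k + 2) from sub_pos.2 hlast),
      Int.sign_eq_neg_one_of_neg
        (show layerPath h n i k (0 + 1) - layerPath h n i k 0 < 0 from sub_neg.2 hfirst), hIcc, Finset.sum_Ico_eq_sum_range,
      Nat.add_sub_cancel_left, Finset.mul_sum]
    have hterm : ∀ x ∈ Finset.range (k + 1), (-1 : ℤ) ^ (x + 1) *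
        (layerPath h n i k (x + 1 + 1) - layerPath h n i k (x + 1)).sign =
        (-1) ^ i * (μ (i + x)).toSign := by
      intro x hx
      rw [Finset.mem_range] at hx
      rw [layerPath_of_mem (by omega) (by omega), layerPath_of_mem (by omega) (by omega),
        show i + (x + 1 + 1) - 2 = i + x by omega, show i + (x + 1) - 2 = i + x - 1 by omega]
      have hx' := hdir (i + x) (by omega) (by omega)
      rw [hlt _ _ (by omega) (by omega)] at hx'
      have hne : h (i + x - 1) ≠ h (i + x) := fun he => by
        have := hinj _ _ (by omega) (by omega) he
        omega
      have hsgn : (h (i + x) - h (i + x - 1)).sign = (-1) ^ (i + x - 1) * (μ (i + x)).toSign := by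
        rcases Nat.even_or_odd (i + x - 1) with hp | hp
        · have hp' : ¬ Odd (i + x - 1) := Nat.not_odd_iff_even.2 hp
          cases hm : μ (i + x) <;> simp [hm, hp, hp', MV.toSign, hp.neg_one_pow] at hx' ⊢ <;> omega
        · have hp' : ¬ Even (i + x - 1) := Nat.not_even_iff_odd.2 hp
          cases hm : μ (i + x) <;> simp [hm, hp, hp', MV.toSign, hp.neg_one_pow] at hx' ⊢ <;> omega
      have hpow : (-1 : ℤ) ^ (x + 1) * (-1) ^ (i + x - 1) = (-1) ^ i := by
        rw [← pow_add, show x + 1 + (i + x - 1) = i + 2 * x by omega, pow_add, pow_mul]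
        norm_num
      rw [hsgn, ← mul_assoc, hpow]
    rw [Finset.sum_congr rfl hterm]
    ring
  have hturn := hpath.alternatingTurn_eq (by omega)
  rw [hsum, sum_toSign] at hturn
  refine ⟨fun hpar => ?_, fun hpar => ?_⟩
  · have hk' : Odd k := by rw [Nat.odd_iff]; rw [Nat.even_iff] at hpar; omega
    have := hturn.1 (by rw [Nat.even_iff] at hpar ⊢; omega)
    rw [hk'.neg_one_pow] at this
    rcases neg_one_pow_eq_or ℤ i with hs | hs <;> rw [hs] at this <;> omega
  · have hk' : Even k := by rw [Nat.even_iff]; rw [Nat.odd_iff] at hpar; omega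
    have := hturn.2 (by rw [Nat.odd_iff] at hpar ⊢; omega)
    rw [hk'.neg_one_pow] at this
    rcases neg_one_pow_eq_or ℤ i with hs | hs <;> rw [hs] at this <;> omega
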